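/- Let D, T ∈ ℝ^{m×n}. The infimum of tr((DX − T)ᵀ(D − T·X⁻¹)) over all symmetric positive definite X ∈ ℝ^{n×n} equals the infimum of ‖D·Y − T·Y⁻ᵀ‖_F² over all invertible Y ∈ ℝ^{n×n}; moreover, an invertible Y attains the latter infimum if and only if X = Y·Yᵀ attains the former. -/

import Mathlib

open Matrix

/-- The Frobenius norm squared of a real matrix. -/
def frobNormSq {m n : ℕ} (M : Matrix (Fin m) (Fin n) ℝ) : ℝ :=
  ∑ i, ∑ j, (M i j) ^ 2

theorem frobNormSq_eq_trace {m n : ℕ} (A : Matrix (Fin m) (Fin n) ℝ) :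
    frobNormSq A = Matrix.trace (Aᵀ * A) := by
  simp only [frobNormSq, Matrix.trace, Matrix.diag, Matrix.mul_apply, Matrix.transpose_apply,
    ← pow_two]
  exact Finset.sum_comm

theorem trace_error_mul_transpose_self {m n : ℕ} (D T : Matrix (Fin m) (Fin n) ℝ)
    (Y : Matrix (Fin n) (Fin n) ℝ) (hY : IsUnit Y.det) :
    Matrix.trace ((D * (Y * Yᵀ) - T)ᵀ * (D - T * (Y * Yᵀ)⁻¹)) =
      frobNormSq (D * Y - T * (Y⁻¹)ᵀ) := by
  have hleft : D * (Y * Yᵀ) - T = (D * Y - T * (Y⁻¹)ᵀ) * Yᵀ := by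
    rw [Matrix.sub_mul, Matrix.mul_assoc D, Matrix.mul_assoc T, ← Matrix.transpose_mul,
      Matrix.mul_nonsing_inv Y hY, Matrix.transpose_one, Matrix.mul_one]
  have hright : D - T * (Y * Yᵀ)⁻¹ = (D * Y - T * (Y⁻¹)ᵀ) * Y⁻¹ := by
    rw [Matrix.sub_mul, Matrix.mul_assoc D, Matrix.mul_assoc T, Matrix.mul_nonsing_inv Y hY,
      Matrix.mul_one, Matrix.mul_inv_rev, Matrix.transpose_nonsing_inv]
  rw [hleft, hright, frobNormSq_eq_trace, Matrix.transpose_mul, Matrix.transpose_transpose,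
    ← Matrix.mul_assoc, Matrix.trace_mul_comm, Matrix.mul_assoc Y, ← Matrix.mul_assoc Y⁻¹,
    Matrix.nonsing_inv_mul Y hY, Matrix.one_mul]

open scoped MatrixOrder Matrix.Norms.L2Operator in
theorem posDef_iff_exists_eq_mul_transpose_self {n : ℕ} (X : Matrix (Fin n) (Fin n) ℝ) :
    X.PosDef ↔ ∃ Y : Matrix (Fin n) (Fin n) ℝ, IsUnit Y.det ∧ X = Y * Yᵀ := by
  constructor
  · intro hX
    obtain ⟨B, hB⟩ := CStarAlgebra.nonneg_iff_eq_star_mul_self.mp hX.posSemidef.nonneg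
    rw [Matrix.star_eq_conjTranspose, Matrix.conjTranspose_eq_transpose_of_trivial] at hB
    refine ⟨Bᵀ, ?_, by rwa [Matrix.transpose_transpose]⟩
    have hdet := hX.det_pos.ne'
    rw [hB, Matrix.det_mul] at hdet
    exact (left_ne_zero_of_mul hdet).isUnit
  · rintro ⟨Y, hY, rfl⟩
    rw [← Matrix.conjTranspose_eq_transpose_of_trivial]
    exact Matrix.PosDef.mul_conjTranspose_self Y
      (Matrix.vecMul_injective_of_isUnit ((Matrix.isUnit_iff_isUnit_det Y).mpr hY))

/-- The infimum of `tr((DX − T)ᵀ (D − T X⁻¹))` over symmetric positive definite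
`X` equals the infimum of `‖D Y − T Y⁻ᵀ‖_F²` over invertible `Y`; moreover, an
invertible `Y` attains the latter infimum iff `X = Y Yᵀ` attains the former. -/
theorem stmt16 {m n : ℕ} (D T : Matrix (Fin m) (Fin n) ℝ) :
    sInf {e : ℝ | ∃ X : Matrix (Fin n) (Fin n) ℝ, X.PosDef ∧
        e = Matrix.trace ((D * X - T)ᵀ * (D - T * X⁻¹))} =
      sInf {e : ℝ | ∃ Y : Matrix (Fin n) (Fin n) ℝ, IsUnit Y.det ∧
        e = frobNormSq (D * Y - T * (Y⁻¹)ᵀ)} ∧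
    ∀ Y : Matrix (Fin n) (Fin n) ℝ, IsUnit Y.det →
      ((∀ Y' : Matrix (Fin n) (Fin n) ℝ, IsUnit Y'.det →
          frobNormSq (D * Y - T * (Y⁻¹)ᵀ) ≤ frobNormSq (D * Y' - T * (Y'⁻¹)ᵀ)) ↔
        (∀ X : Matrix (Fin n) (Fin n) ℝ, X.PosDef →
          Matrix.trace ((D * (Y * Yᵀ) - T)ᵀ * (D - T * (Y * Yᵀ)⁻¹)) ≤
            Matrix.trace ((D * X - T)ᵀ * (D - T * X⁻¹)))) := by
  constructor
  · congr 1
    ext e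
    simp only [Set.mem_ofPred_eq, posDef_iff_exists_eq_mul_transpose_self]
    constructor
    · rintro ⟨_, ⟨Y, hY, rfl⟩, rfl⟩
      exact ⟨Y, hY, trace_error_mul_transpose_self D T Y hY⟩
    · rintro ⟨Y, hY, rfl⟩
      exact ⟨_, ⟨Y, hY, rfl⟩, (trace_error_mul_transpose_self D T Y hY).symm⟩
  · intro Y hY
    rw [trace_error_mul_transpose_self D T Y hY]
    simp only [posDef_iff_exists_eq_mul_transpose_self]
    constructor
    · rintro h _ ⟨Z, hZ, rfl⟩
      rw [trace_error_mul_transpose_self D T Z hZ]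
      exact h Z hZ
    · intro h Z hZ
      rw [← trace_error_mul_transpose_self D T Z hZ]
      exact h _ ⟨Z, hZ, rfl⟩
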